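/- For every n ≥ 1 the algebra homomorphism I_n : TL_n → TL_{n+1} is injective. -/

import Mathlib

noncomputable section

namespace SkeinTL

inductive TLgen (n : ℕ) : Type
  | e : ZMod n → TLgen n
  | r : TLgen n
  | ri : TLgen n

abbrev FA (n : ℕ) : Type := FreeAlgebra ℂ (TLgen n)

def ef (n : ℕ) (i : ZMod n) : FA n := FreeAlgebra.ι ℂ (TLgen.e i)
def rf (n : ℕ) : FA n := FreeAlgebra.ι ℂ TLgen.r
def rif (n : ℕ) : FA n := FreeAlgebra.ι ℂ TLgen.ri

/-- The defining relations of the extended affine Temperley-Lieb algebra.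
For `n = 2` the presentation is the special one (`ρ²e₁ = e₁`), for `n ≥ 3` the
general one (indices mod `n`). -/
inductive TLrel (t4 : ℂ) (n : ℕ) : FA n → FA n → Prop
  | esq (i : ZMod n) :
      TLrel t4 n (ef n i * ef n i) ((-(t4 ^ 2 + t4⁻¹ ^ 2)) • ef n i)
  | rer (i : ZMod n) :
      TLrel t4 n (rf n * ef n i) (ef n (i + 1) * rf n)
  | rri : TLrel t4 n (rf n * rif n) 1
  | rir : TLrel t4 n (rif n * rf n) 1
  | comm (h : 3 ≤ n) (i j : ZMod n) (h1 : i - j ≠ 1) (h2 : i - j ≠ -1) :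
      TLrel t4 n (ef n i * ef n j) (ef n j * ef n i)
  | eplus (h : 3 ≤ n) (i : ZMod n) :
      TLrel t4 n (ef n i * ef n (i + 1) * ef n i) (ef n i)
  | eminus (h : 3 ≤ n) (i : ZMod n) :
      TLrel t4 n (ef n i * ef n (i - 1) * ef n i) (ef n i)
  | cyc (h : 3 ≤ n) :
      TLrel t4 n ((rf n * ef n 1) ^ (n - 1)) (rf n ^ n * (rf n * ef n 1))
  | two (h : n = 2) :
      TLrel t4 n (rf n * rf n * ef n 1) (ef n 1)

/-- The extended affine Temperley-Lieb algebra `TL_n` (for `n ≥ 2`). -/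
abbrev TL (t4 : ℂ) (n : ℕ) : Type := RingQuot (TLrel t4 n)

/-- The generator `e_i` of `TL_n` (index mod `n`). -/
def E (t4 : ℂ) (n : ℕ) (i : ZMod n) : TL t4 n :=
  RingQuot.mkAlgHom ℂ (TLrel t4 n) (ef n i)

/-- The generator `ρ` of `TL_n`. -/
def R (t4 : ℂ) (n : ℕ) : TL t4 n :=
  RingQuot.mkAlgHom ℂ (TLrel t4 n) (rf n)

/-- The generator `ρ⁻¹` of `TL_n`. -/
def Ri (t4 : ℂ) (n : ℕ) : TL t4 n :=
  RingQuot.mkAlgHom ℂ (TLrel t4 n) (rif n)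

/-- The scalar `c` viewed in `TL_n`. -/
def Ct (t4 : ℂ) (n : ℕ) (c : ℂ) : TL t4 n := algebraMap ℂ (TL t4 n) c


/-- The defining conditions of the arc-insertion algebra map `I_n : TL_n → TL_{n+1}`
(`n ≥ 2`): `I_n(e_i) = e_i` for `1 ≤ i ≤ n-1`,
`I_n(e_n) = (t^{1/4}e_n + t^{-1/4})e_{n+1}(t^{-1/4}e_n + t^{1/4})`,
`I_n(ρ) = ρ(t^{-1/4}e_n + t^{1/4})`, `I_n(ρ⁻¹) = (t^{1/4}e_n + t^{-1/4})ρ⁻¹`. -/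
def InsCond (t4 : ℂ) (n : ℕ) (I : TL t4 n →ₐ[ℂ] TL t4 (n + 1)) : Prop :=
  (∀ i : ℕ, 1 ≤ i → i ≤ n - 1 →
      I (E t4 n (i : ZMod n)) = E t4 (n + 1) (i : ZMod (n + 1))) ∧
  I (E t4 n (n : ZMod n)) =
    (t4 • E t4 (n + 1) (n : ZMod (n + 1)) + Ct t4 (n + 1) t4⁻¹) *
      E t4 (n + 1) ((n + 1 : ℕ) : ZMod (n + 1)) *
      (t4⁻¹ • E t4 (n + 1) (n : ZMod (n + 1)) + Ct t4 (n + 1) t4) ∧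
  I (R t4 n) = R t4 (n + 1) * (t4⁻¹ • E t4 (n + 1) (n : ZMod (n + 1)) + Ct t4 (n + 1) t4) ∧
  I (Ri t4 n) = (t4 • E t4 (n + 1) (n : ZMod (n + 1)) + Ct t4 (n + 1) t4⁻¹) * Ri t4 (n + 1)

/-- The defining conditions of `I_1 : TL_1 → TL_2`, where `TL_1 = ℂ[ρ,ρ⁻¹]` is the
Laurent polynomial algebra with `ρ = T 1`, `ρ⁻¹ = T (-1)`. -/
def InsCondOne (t4 : ℂ) (I : LaurentPolynomial ℂ →ₐ[ℂ] TL t4 2) : Prop :=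
  I (LaurentPolynomial.T 1) = R t4 2 * (t4⁻¹ • E t4 2 1 + Ct t4 2 t4) ∧
  I (LaurentPolynomial.T (-1)) = (t4 • E t4 2 1 + Ct t4 2 t4⁻¹) * Ri t4 2

section BasicConstruction

variable {A : Type*} [Ring A] [Algebra ℂ A]

/-- `π` is a `B`-bimodule map of `A` into the subalgebra `B` with `π 1 = δ`, and the
quasi-idempotent `e` satisfies `e * A = e * B` and `A * e = B * e` through `π`. -/
structure IsExpectation (δ : ℂ) (B : Subalgebra ℂ A) (π : A →ₗ[ℂ] A) (e : A) : Prop where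
  mem : ∀ x, π x ∈ B
  left : ∀ b ∈ B, ∀ x, π (b * x) = b * π x
  right : ∀ b ∈ B, ∀ x, π (x * b) = π x * b
  one : π 1 = δ • (1 : A)
  sq : e * e = δ • e
  absorb_left : ∀ x, e * π (e * x) = e * x
  absorb_right : ∀ x, π (x * e) * e = x * e

/-- The left `A`-linear maps to `A` from the basic construction `A ⊕ (A ⊗[B] A)`, taken modulo
`e ⊗ e = e`; such a map is recorded by its values at `1` and at the elements `1 ⊗ b`. -/
def basicDual (B : Subalgebra ℂ A) (e : A) : Submodule ℂ (A × (A →ₗ[ℂ] A)) where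
  carrier := {φ | (∀ b ∈ B, ∀ x, φ.2 (b * x) = b * φ.2 x) ∧
    ∀ x, e * φ.2 (e * x) = e * x * φ.1}
  add_mem' {φ ψ} hφ hψ := by
    refine ⟨fun b hb x => ?_, fun x => ?_⟩
    · simp [hφ.1 b hb, hψ.1 b hb, mul_add]
    · simp [mul_add, hφ.2, hψ.2]
  zero_mem' := by simp
  smul_mem' c φ hφ := by
    refine ⟨fun b hb x => ?_, fun x => ?_⟩
    · simp [hφ.1 b hb]
    · simp [hφ.2]

namespace basicDual

variable {B : Subalgebra ℂ A} {e : A}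

instance : Ring (Module.End ℂ (basicDual B e)) := Algebra.semiringToRing ℂ

/-- The action of `A` on `basicDual B e` by right translation of the argument. -/
def act (B : Subalgebra ℂ A) (e : A) : A →ₐ[ℂ] Module.End ℂ (basicDual B e) where
  toFun a :=
    { toFun := fun φ => ⟨(a * φ.1.1, φ.1.2 ∘ₗ LinearMap.mulRight ℂ a), by
        refine ⟨fun b hb x => ?_, fun x => ?_⟩
        · simpa [mul_assoc] using φ.2.1 b hb (x * a)
        · simpa [mul_assoc] using φ.2.2 (x * a)⟩
      map_add' := fun φ ψ => by
        ext <;> simp [mul_add]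
      map_smul' := fun c φ => by
        ext <;> simp }
  map_one' := by ext <;> simp
  map_mul' a b := by ext <;> simp [mul_assoc]
  map_zero' := by ext <;> simp
  map_add' a b := by ext <;> simp [add_mul, mul_add]
  commutes' c := by ext <;> simp [Algebra.algebraMap_eq_smul_one]

@[simp] lemma act_fst (a : A) (φ : basicDual B e) : (act B e a φ).1.1 = a * φ.1.1 := rfl

@[simp] lemma act_snd (a : A) (φ : basicDual B e) (x : A) :
    (act B e a φ).1.2 x = φ.1.2 (x * a) := rfl

/-- Right multiplication on the values of the elements of `basicDual B e`. -/
def rmul (B : Subalgebra ℂ A) (e a : A) : Module.End ℂ (basicDual B e) where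
  toFun φ := ⟨(φ.1.1 * a, LinearMap.mulRight ℂ a ∘ₗ φ.1.2), by
    refine ⟨fun b hb x => ?_, fun x => ?_⟩
    · simp [φ.2.1 b hb, mul_assoc]
    · simp only [LinearMap.comp_apply, LinearMap.mulRight_apply]
      rw [← mul_assoc, φ.2.2 x, mul_assoc (e * x)]⟩
  map_add' φ ψ := by ext <;> simp [add_mul]
  map_smul' c φ := by ext <;> simp

@[simp] lemma rmul_fst (a : A) (φ : basicDual B e) : (rmul B e a φ).1.1 = φ.1.1 * a := rfl

@[simp] lemma rmul_snd (a : A) (φ : basicDual B e) (x : A) :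
    (rmul B e a φ).1.2 x = φ.1.2 x * a := rfl

variable {δ : ℂ} {π : A →ₗ[ℂ] A}

/-- The action of the Jones projection on `basicDual B e`. -/
def jones (h : IsExpectation δ B π e) : Module.End ℂ (basicDual B e) where
  toFun φ := ⟨(φ.1.2 1, LinearMap.mulRight ℂ (φ.1.2 1) ∘ₗ π), by
    refine ⟨fun b hb x => ?_, fun x => ?_⟩
    · simp [h.left b hb, mul_assoc]
    · simp only [LinearMap.comp_apply, LinearMap.mulRight_apply]
      rw [← mul_assoc, h.absorb_left]⟩
  map_add' φ ψ := by ext <;> simp [mul_add]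
  map_smul' c φ := by ext <;> simp

variable (h : IsExpectation δ B π e)

@[simp] lemma jones_fst (φ : basicDual B e) : (jones h φ).1.1 = φ.1.2 1 := rfl

@[simp] lemma jones_snd (φ : basicDual B e) (x : A) :
    (jones h φ).1.2 x = π x * φ.1.2 1 := rfl

/-- The bimodule map `A ⊕ (A ⊗[B] A) → A` given by `1 ↦ δ` and `a ⊗ b ↦ a * b`. -/
def mulPoint : basicDual B e :=
  ⟨(δ • 1, LinearMap.id), fun b _ x => rfl, fun x => by
    simp [← mul_assoc, h.sq]⟩

@[simp] lemma mulPoint_fst : (mulPoint h).1.1 = δ • (1 : A) := rfl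

@[simp] lemma mulPoint_snd (x : A) : (mulPoint h).1.2 x = x := rfl

lemma ext_iff' {φ ψ : basicDual B e} : φ = ψ ↔ φ.1.1 = ψ.1.1 ∧ ∀ x, φ.1.2 x = ψ.1.2 x := by
  rw [Subtype.ext_iff, Prod.ext_iff, LinearMap.ext_iff]

lemma jones_mul_act_mul_jones (a : A) :
    jones h * act B e a * jones h = act B e (π a) * jones h := by
  refine LinearMap.ext fun φ => ext_iff'.2 ⟨by simp, fun x => ?_⟩
  simp [h.right _ (h.mem a), mul_assoc]

lemma jones_mul_act {b : A} (hb : b ∈ B) :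
    jones h * act B e b = act B e b * jones h := by
  refine LinearMap.ext fun φ => ext_iff'.2 ⟨?_, fun x => ?_⟩
  · simpa using φ.2.1 b hb 1
  · have := φ.2.1 b hb 1
    rw [mul_one] at this
    simp [this, h.right b hb, mul_assoc]

lemma jones_mul_jones : jones h * jones h = δ • jones h := by
  have := jones_mul_act_mul_jones h 1
  simpa [h.one, map_smul] using this

lemma act_mul_jones_mul_act :
    act B e e * jones h * act B e e = act B e e := by
  refine LinearMap.ext fun φ => ext_iff'.2 ⟨?_, fun x => ?_⟩
  · simpa using φ.2.2 1
  · have := φ.2.1 _ (h.mem (x * e)) e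
    rw [h.absorb_right] at this
    simp [this]

lemma jones_mul_act_self_mul_jones (h1 : π e = 1) :
    jones h * act B e e * jones h = jones h := by
  rw [jones_mul_act_mul_jones, h1, map_one, one_mul]

lemma commute_act_rmul (a b : A) : Commute (act B e a) (rmul B e b) :=
  LinearMap.ext fun φ => ext_iff'.2 ⟨by simp [mul_assoc], fun x => by simp⟩

lemma commute_jones_rmul (b : A) : Commute (jones h) (rmul B e b) :=
  LinearMap.ext fun φ => ext_iff'.2 ⟨by simp, fun x => by simp [mul_assoc]⟩

lemma act_mulPoint (a : A) : act B e a (mulPoint h) = rmul B e a (mulPoint h) :=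
  ext_iff'.2 ⟨by simp, fun x => by simp⟩

end basicDual

open basicDual

/-- An algebra generated by `A` and a Jones projection `e'`, compatibly with the action of the
basic construction on `basicDual B e`. -/
structure IsJonesExtension {δ : ℂ} {B : Subalgebra ℂ A} {π : A →ₗ[ℂ] A} {e : A}
    (h : IsExpectation δ B π e) {A' : Type*} [Ring A'] [Algebra ℂ A'] (I : A →ₐ[ℂ] A') (e' : A')
    (Φ : A' →ₐ[ℂ] Module.End ℂ (basicDual B e)) : Prop where
  map_base : ∀ a, Φ (I a) = act B e a
  map_proj : Φ e' = jones h
  adjoin_eq : Algebra.adjoin ℂ (Set.range I ∪ {e'}) = ⊤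
  sq : e' * e' = δ • e'
  comm : ∀ b ∈ B, e' * I b = I b * e'
  jones : ∀ a, e' * I a * e' = I (π a) * e'

namespace IsJonesExtension

variable {δ : ℂ} {B : Subalgebra ℂ A} {π : A →ₗ[ℂ] A} {e : A} {h : IsExpectation δ B π e}
  {A' : Type*} [Ring A'] [Algebra ℂ A'] {I : A →ₐ[ℂ] A'} {e' : A'}
  {Φ : A' →ₐ[ℂ] Module.End ℂ (basicDual B e)}

variable (Φ) in
/-- The conditional expectation of the extension onto `A`. -/
def toBase (h : IsExpectation δ B π e) : A' →ₗ[ℂ] A :=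
  LinearMap.fst ℂ A (A →ₗ[ℂ] A) ∘ₗ (basicDual B e).subtype ∘ₗ
    LinearMap.applyₗ (mulPoint h) ∘ₗ Φ.toLinearMap

lemma toBase_apply (y : A') : toBase Φ h y = (Φ y (mulPoint h)).1.1 := rfl

lemma toBase_one : toBase Φ h 1 = δ • (1 : A) := by
  simp [toBase_apply]

variable (hJ : IsJonesExtension h I e' Φ)
include hJ

lemma toBase_left (a : A) (y : A') : toBase Φ h (I a * y) = a * toBase Φ h y := by
  simp [toBase_apply, hJ.map_base]

lemma commute_rmul (a : A) (y : A') : Commute (Φ y) (rmul B e a) := by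
  have hy : y ∈ Algebra.adjoin ℂ (Set.range I ∪ {e'}) := hJ.adjoin_eq ▸ Algebra.mem_top
  induction hy using Algebra.adjoin_induction with
  | mem x hx =>
    rcases hx with ⟨b, rfl⟩ | rfl
    · rw [hJ.map_base]; exact commute_act_rmul _ _
    · rw [hJ.map_proj]; exact commute_jones_rmul _ _
  | algebraMap r => rw [AlgHom.commutes]; exact Algebra.commute_algebraMap_left _ _
  | add x y _ _ hx hy => rw [map_add]; exact hx.add_left hy
  | mul x y _ _ hx hy => rw [map_mul]; exact hx.mul_left hy

lemma toBase_right (a : A) (y : A') : toBase Φ h (y * I a) = toBase Φ h y * a := by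
  have := LinearMap.congr_fun (hJ.commute_rmul a y).eq (mulPoint h)
  simp only [Module.End.mul_apply] at this
  simp [toBase_apply, hJ.map_base, act_mulPoint, this]

lemma toBase_proj : toBase Φ h e' = 1 := by
  simp [toBase_apply, hJ.map_proj]

lemma toBase_proj_mul (a : A) : toBase Φ h (e' * I a) = a := by
  rw [hJ.toBase_right, hJ.toBase_proj, one_mul]

lemma toBase_mul_proj (a : A) : toBase Φ h (I a * e') = a := by
  rw [hJ.toBase_left, hJ.toBase_proj, mul_one]

lemma injective : Function.Injective I :=
  Function.LeftInverse.injective (g := fun y => toBase Φ h (e' * y)) hJ.toBase_proj_mul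

lemma span_induction {p : A' → Prop} (add : ∀ x y, p x → p y → p (x + y))
    (base : ∀ a, p (I a)) (proj : ∀ a b, p (I a * e' * I b)) (y : A') : p y := by
  let S := AddSubmonoid.closure (Set.range I ∪ {z | ∃ a b, z = I a * e' * I b})
  have hbase : ∀ a, I a ∈ S := fun a => AddSubmonoid.subset_closure (Or.inl ⟨a, rfl⟩)
  have hproj : ∀ a b, I a * e' * I b ∈ S :=
    fun a b => AddSubmonoid.subset_closure (Or.inr ⟨a, b, rfl⟩)
  have hleft : ∀ c : A', (∀ a, c * I a ∈ S) → (∀ a b, c * (I a * e' * I b) ∈ S) →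
      ∀ s ∈ S, c * s ∈ S := by
    intro c h1 h2 s hs
    induction hs using AddSubmonoid.closure_induction with
    | mem x hx => rcases hx with ⟨a, rfl⟩ | ⟨a, b, rfl⟩ <;> solve_by_elim
    | zero => rw [mul_zero]; exact zero_mem _
    | add x y _ _ hx hy => rw [mul_add]; exact add_mem hx hy
  have hmulI : ∀ a, ∀ s ∈ S, I a * s ∈ S := by
    refine fun a => hleft _ (fun b => ?_) fun b c => ?_
    · rw [← map_mul]; exact hbase _
    · rw [← mul_assoc, ← mul_assoc, ← map_mul]; exact hproj _ _
  have hmule : ∀ s ∈ S, e' * s ∈ S := by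
    refine hleft _ (fun b => ?_) fun b c => ?_
    · simpa using hproj 1 b
    · rw [← mul_assoc, ← mul_assoc, hJ.jones]; exact hproj _ _
  have hall : ∀ s ∈ S, y * s ∈ S := by
    have hy : y ∈ Algebra.adjoin ℂ (Set.range I ∪ {e'}) := hJ.adjoin_eq ▸ Algebra.mem_top
    induction hy using Algebra.adjoin_induction with
    | mem x hx => rcases hx with ⟨a, rfl⟩ | rfl <;> solve_by_elim
    | algebraMap r => rw [← AlgHom.commutes I]; exact hmulI _
    | add x y _ _ hx hy => intro s hs; rw [add_mul]; exact add_mem (hx s hs) (hy s hs)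
    | mul x y _ _ hx hy => intro s hs; rw [mul_assoc]; exact hx _ (hy s hs)
  have hyS : y ∈ S := by simpa using hall (I 1) (hbase 1)
  clear hall
  induction hyS using AddSubmonoid.closure_induction with
  | mem x hx => rcases hx with ⟨a, rfl⟩ | ⟨a, b, rfl⟩ <;> solve_by_elim
  | zero => simpa using base 0
  | add x y _ _ hx hy => exact add _ _ hx hy

lemma isExpectation :
    IsExpectation δ I.range (I.toLinearMap ∘ₗ toBase Φ h) e' where
  mem x := ⟨_, rfl⟩
  left := by
    rintro _ ⟨a, rfl⟩ x
    simp [hJ.toBase_left]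
  right := by
    rintro _ ⟨a, rfl⟩ x
    simp [hJ.toBase_right]
  one := by simp [toBase_one]
  sq := hJ.sq
  absorb_left x := by
    have key : ∀ c, e' * I (toBase Φ h (e' * I c)) = e' * I c := fun c => by
      rw [hJ.toBase_proj_mul]
    refine hJ.span_induction (p := fun x => e' * I (toBase Φ h (e' * x)) = e' * x)
      (fun x y hx hy => ?_) key (fun a b => ?_) x
    · rw [mul_add, map_add, map_add, mul_add, hx, hy]
    · have : e' * (I a * e' * I b) = e' * I (π a * b) := by
        rw [← mul_assoc, ← mul_assoc, hJ.jones, ← hJ.comm _ (h.mem a), map_mul, mul_assoc]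
      rw [this, key]
  absorb_right x := by
    have key : ∀ c, I (toBase Φ h (I c * e')) * e' = I c * e' := fun c => by
      rw [hJ.toBase_mul_proj]
    refine hJ.span_induction (p := fun x => I (toBase Φ h (x * e')) * e' = x * e')
      (fun x y hx hy => ?_) key (fun a b => ?_) x
    · rw [add_mul, map_add, map_add, add_mul, hx, hy]
    · have : I a * e' * I b * e' = I (a * π b) * e' := by
        rw [mul_assoc (I a), mul_assoc (I a), hJ.jones, ← mul_assoc, map_mul]
      rw [this, key]

end IsJonesExtension

end BasicConstruction

section Crossings

variable {C : Type*} [Ring C] [Algebra ℂ C]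

/-- The crossing `a x + a⁻¹`; its inverse is `crossing a⁻¹ x` when `x² = -(a² + a⁻²) x`. -/
def crossing (a : ℂ) (x : C) : C := a • x + algebraMap ℂ C a⁻¹

/-- The loop weight. -/
abbrev loop (a : ℂ) : ℂ := -(a ^ 2 + a⁻¹ ^ 2)

lemma loop_inv (a : ℂ) : loop a⁻¹ = loop a := by
  simp [loop, add_comm]

lemma map_crossing {C' : Type*} [Ring C'] [Algebra ℂ C'] (f : C →ₐ[ℂ] C') (a : ℂ) (x : C) :
    f (crossing a x) = crossing a (f x) := by
  simp [crossing]

lemma Commute.crossing_right {x z : C} (h : Commute z x) (a : ℂ) :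
    Commute z (crossing a x) :=
  (h.smul_right a).add_right (Algebra.commute_algebraMap_right _ _)

lemma crossing_mul_comm {a : ℂ} {x y z : C} (h : z * x = y * z) :
    z * crossing a x = crossing a y * z := by
  simp [crossing, mul_add, add_mul, h, Algebra.commutes]

variable {a : ℂ} (ha : a ≠ 0) {x y : C} (hx : x * x = loop a • x)
  (hxy : x * y * x = x)

include ha hx

lemma crossing_mul_crossing_inv : crossing a x * crossing a⁻¹ x = 1 := by
  simp only [crossing, Algebra.algebraMap_eq_smul_one, mul_add, add_mul, smul_mul_assoc,
    mul_smul_comm, mul_one, one_mul, hx, loop]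
  match_scalars <;> field_simp
  ring

lemma crossing_mul_self : crossing a x * x = (-a ^ 3) • x := by
  simp only [crossing, Algebra.algebraMap_eq_smul_one, add_mul, smul_mul_assoc, one_mul, hx, loop]
  match_scalars; field_simp; ring

lemma self_mul_crossing : x * crossing a x = (-a ^ 3) • x := by
  simp only [crossing, Algebra.algebraMap_eq_smul_one, mul_add, mul_smul_comm, mul_one, hx, loop]
  match_scalars; field_simp; ring

include hxy

lemma mul_crossing_mul_crossing : x * crossing a y * crossing a x = x * y := by
  simp only [crossing, Algebra.algebraMap_eq_smul_one, mul_add, add_mul, smul_mul_assoc,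
    mul_smul_comm, mul_one, hxy, hx, loop, smul_add]
  match_scalars <;> field_simp; ring

lemma crossing_mul_crossing_mul : crossing a x * crossing a y * x = y * x := by
  simp only [crossing, Algebra.algebraMap_eq_smul_one, mul_add, add_mul, smul_mul_assoc,
    mul_smul_comm, mul_one, one_mul, hxy, hx, loop, smul_add]
  match_scalars <;> field_simp; ring

end Crossings

section TLData

variable {C : Type*} [Ring C] [Algebra ℂ C]

/-- The product `e 1 * e 2 * ⋯ * e k`. -/
def word (e : ℕ → C) : ℕ → C
  | 0 => 1
  | k + 1 => word e k * e (k + 1)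

lemma word_congr {C : Type*} [Ring C] {e f : ℕ → C} {k : ℕ} (h : ∀ i, 1 ≤ i → i ≤ k → e i = f i) :
    word e k = word f k := by
  induction k with
  | zero => rfl
  | succ k ih =>
    rw [word, word, ih fun i h1 h2 => h i h1 (by omega), h (k + 1) (by omega) le_rfl]

lemma map_word {C' : Type*} [Ring C'] [Algebra ℂ C'] (f : C →ₐ[ℂ] C') (e : ℕ → C) (k : ℕ) :
    f (word e k) = word (fun i => f (e i)) k := by
  induction k with
  | zero => simp [word]
  | succ k ih => simp [word, ih]

/-- A presentation of the extended affine Temperley-Lieb algebra on `k + 1` strands by the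
generators `e 1, …, e k`, `r` and `r' = r⁻¹`. -/
structure TLData (a : ℂ) (k : ℕ) (r r' : C) (e : ℕ → C) : Prop where
  mul_inv : r * r' = 1
  inv_mul : r' * r = 1
  sq : ∀ i, 1 ≤ i → i ≤ k → e i * e i = loop a • e i
  shift : ∀ i, 1 ≤ i → i + 1 ≤ k → r * e i = e (i + 1) * r
  shift_top : r * r * e k = e 1 * (r * r)
  up : ∀ i, 1 ≤ i → i + 1 ≤ k → e i * e (i + 1) * e i = e i
  down : ∀ i, 1 ≤ i → i + 1 ≤ k → e (i + 1) * e i * e (i + 1) = e (i + 1)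
  comm : ∀ i j, 1 ≤ i → i + 2 ≤ j → j ≤ k → Commute (e i) (e j)
  top : r * r * e k = word e k

namespace TLData

lemma map {C' : Type*} [Ring C'] [Algebra ℂ C'] (f : C →ₐ[ℂ] C') {a : ℂ} {k : ℕ} {r r' : C}
    {e : ℕ → C} (h : TLData a k r r' e) : TLData a k (f r) (f r') (fun i => f (e i)) where
  mul_inv := by rw [← map_mul, h.mul_inv, map_one]
  inv_mul := by rw [← map_mul, h.inv_mul, map_one]
  sq i h1 h2 := by rw [← map_mul, h.sq i h1 h2, map_smul]
  shift i h1 h2 := by rw [← map_mul, h.shift i h1 h2, map_mul]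
  shift_top := by simp only [← map_mul, h.shift_top]
  up i h1 h2 := by rw [← map_mul, ← map_mul, h.up i h1 h2]
  down i h1 h2 := by rw [← map_mul, ← map_mul, h.down i h1 h2]
  comm i j h1 h2 h3 := (h.comm i j h1 h2 h3).map f
  top := by rw [← map_mul, ← map_mul, h.top, map_word]

variable {a : ℂ} (ha : a ≠ 0) {k : ℕ} {r r' : C} {e : ℕ → C}
include ha

/-- Adding a strand: a Jones projection `ε` over the subalgebra on one strand less turns
generators on `k + 1` strands into generators on `k + 2` strands. -/
lemma extend (hk : 1 ≤ k) (h : TLData a k r r' e) {ε : C} (hsq : ε * ε = loop a • ε)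
    (hup : e k * ε * e k = e k) (hdown : ε * e k * ε = ε)
    (hr : Commute ε (r * crossing a⁻¹ (e k))) (hcomm : ∀ i, 1 ≤ i → i + 1 ≤ k → Commute ε (e i)) :
    TLData a (k + 1) (r * crossing a ε) (crossing a⁻¹ ε * r') (Function.update e (k + 1) ε) := by
  have hai := inv_ne_zero ha
  have hek := h.sq k hk le_rfl
  have hek' : e k * e k = loop a⁻¹ • e k := by rw [loop_inv]; exact hek
  have hsq' : ε * ε = loop a⁻¹ • ε := by rw [loop_inv]; exact hsq
  have hinv := crossing_mul_crossing_inv ha hsq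
  have hinv' := crossing_mul_crossing_inv hai hsq'
  rw [inv_inv] at hinv'
  have hkinv' := crossing_mul_crossing_inv hai hek'
  rw [inv_inv] at hkinv'
  set s := r * crossing a⁻¹ (e k) with hs
  have hrs : r = s * crossing a (e k) := by rw [hs, mul_assoc, hkinv', mul_one]
  have hse : ∀ i, i ≤ k → Function.update e (k + 1) ε i = e i := fun i hi =>
    Function.update_of_ne (by omega) _ _
  have hsε : Function.update e (k + 1) ε (k + 1) = ε := Function.update_self _ _ _
  have hsK : Commute (crossing a ε) s := (Commute.crossing_right hr.symm a).symm
  -- `s` absorbs the crossing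
  have hsek : s * e k = ((-a⁻¹ ^ 3) • r) * e k := by
    rw [hs, mul_assoc, crossing_mul_self hai hek', mul_smul_comm, smul_mul_assoc]
  have hscal : (-a ^ 3) * (-a⁻¹ ^ 3) = (1 : ℂ) := by field_simp
  have hRR : r * crossing a ε * (r * crossing a ε) * ε = r * r * e k * ε := by
    calc r * crossing a ε * (r * crossing a ε) * ε
        = r * crossing a ε * r * (crossing a ε * ε) := by simp only [mul_assoc]
      _ = (-a ^ 3) • (r * (crossing a ε * s) * crossing a (e k) * ε) := by
          rw [crossing_mul_self ha hsq, mul_smul_comm]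
          conv_lhs => enter [2, 1, 2]; rw [hrs]
          simp only [mul_assoc]
      _ = (-a ^ 3) • (r * s * (crossing a ε * crossing a (e k) * ε)) := by
          rw [hsK.eq]; simp only [mul_assoc]
      _ = (-a ^ 3) • (r * (s * e k) * ε) := by
          rw [crossing_mul_crossing_mul ha hsq hdown]; simp only [mul_assoc]
      _ = r * r * e k * ε := by
          rw [hsek]
          simp only [mul_smul_comm, smul_mul_assoc, smul_smul, hscal, one_smul, mul_assoc]
  have hRR' : e 1 * (r * crossing a ε * (r * crossing a ε)) = r * r * e k * ε := by
    calc e 1 * (r * crossing a ε * (r * crossing a ε))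
        = e 1 * r * (crossing a ε * s) * crossing a (e k) * crossing a ε := by
          conv_lhs => enter [2, 2, 1]; rw [hrs]
          simp only [mul_assoc]
      _ = e 1 * (r * r) * crossing a⁻¹ (e k) *
            (crossing a ε * crossing a (e k) * crossing a ε) := by
          rw [hsK.eq, hs]; simp only [mul_assoc]
      _ = r * r * (e k * crossing a⁻¹ (e k)) *
            (crossing a ε * crossing a (e k) * crossing a ε) := by
          rw [← h.shift_top]; simp only [mul_assoc]
      _ = (-a⁻¹ ^ 3) • (r * r * (e k * crossing a ε * crossing a (e k)) * crossing a ε) := by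
          rw [self_mul_crossing hai hek']
          simp only [mul_smul_comm, smul_mul_assoc, mul_assoc]
      _ = (-a⁻¹ ^ 3) • (r * r * e k * (ε * crossing a ε)) := by
          rw [mul_crossing_mul_crossing ha hek hup]; simp only [mul_assoc]
      _ = r * r * e k * ε := by
          rw [self_mul_crossing ha hsq, mul_smul_comm, smul_smul, mul_comm (-a⁻¹ ^ 3), hscal,
            one_smul]
  have hshiftk : r * crossing a ε * e k = ε * (r * crossing a ε) := by
    calc r * crossing a ε * e k = s * (crossing a (e k) * crossing a ε * e k) := by
          rw [hrs]; simp only [mul_assoc]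
      _ = s * (ε * crossing a (e k) * crossing a ε) := by
          rw [crossing_mul_crossing_mul ha hek hup, mul_crossing_mul_crossing ha hsq hdown]
      _ = ε * (r * crossing a ε) := by
          rw [← mul_assoc, ← mul_assoc, ← hr.eq]
          conv_rhs => rw [hrs]
          simp only [mul_assoc]
  constructor
  · rw [mul_assoc, ← mul_assoc (crossing a ε), hinv, one_mul, h.mul_inv]
  · rw [mul_assoc, ← mul_assoc r', h.inv_mul, one_mul, hinv']
  · intro i h1 h2
    rcases Nat.lt_or_ge k i with hi | hi
    · obtain rfl : i = k + 1 := by omega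
      simpa only [hsε] using hsq
    · simpa only [hse i hi] using h.sq i h1 hi
  · intro i h1 h2
    rcases Nat.lt_or_ge i k with hi | hi
    · rw [hse i hi.le, hse (i + 1) hi, mul_assoc,
        ← (Commute.crossing_right (hcomm i h1 hi).symm a).eq, ← mul_assoc, h.shift i h1 hi,
        mul_assoc]
    · obtain rfl : i = k := by omega
      rwa [hse i le_rfl, hsε]
  · rw [hsε, hse 1 hk, hRR, hRR']
  · intro i h1 h2
    rcases Nat.lt_or_ge i k with hi | hi
    · rw [hse i hi.le, hse (i + 1) hi, h.up i h1 hi]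
    · obtain rfl : i = k := by omega
      rwa [hse i le_rfl, hsε]
  · intro i h1 h2
    rcases Nat.lt_or_ge i k with hi | hi
    · rw [hse i hi.le, hse (i + 1) hi, h.down i h1 hi]
    · obtain rfl : i = k := by omega
      rwa [hse i le_rfl, hsε]
  · intro i j h1 h2 h3
    rcases Nat.lt_or_ge k j with hj | hj
    · obtain rfl : j = k + 1 := by omega
      rw [hse i (by omega), hsε]
      exact (hcomm i h1 (by omega)).symm
    · rw [hse i (by omega), hse j hj]
      exact h.comm i j h1 h2 hj
  · rw [hsε, hRR, word, hsε, word_congr fun i _ hi => hse i hi, h.top]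

/-- Restricting to the subalgebra on one strand less. -/
lemma restrict (hk : 1 ≤ k) (h : TLData a (k + 1) r r' e) :
    TLData a k (r * crossing a⁻¹ (e (k + 1))) (crossing a (e (k + 1)) * r') e := by
  have hai := inv_ne_zero ha
  have hx := h.sq k hk (by omega)
  have hx' : e k * e k = loop a⁻¹ • e k := by rw [loop_inv]; exact hx
  have hy := h.sq (k + 1) (by omega) le_rfl
  have hy' : e (k + 1) * e (k + 1) = loop a⁻¹ • e (k + 1) := by rw [loop_inv]; exact hy
  have hxy := h.up k hk le_rfl
  have hinv := crossing_mul_crossing_inv ha hy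
  have hinv' := crossing_mul_crossing_inv hai hy'
  rw [inv_inv] at hinv'
  have hcr := crossing_mul_comm (a := a⁻¹) (h.shift k hk le_rfl)
  have hss : r * crossing a⁻¹ (e (k + 1)) * (r * crossing a⁻¹ (e (k + 1)))
      = r * r * (crossing a⁻¹ (e k) * crossing a⁻¹ (e (k + 1))) := by
    rw [← mul_assoc, mul_assoc r (crossing _ _), ← hcr]; simp only [mul_assoc]
  have htop : r * crossing a⁻¹ (e (k + 1)) * (r * crossing a⁻¹ (e (k + 1))) * e k
      = r * r * e (k + 1) * e k := by
    rw [hss, mul_assoc, crossing_mul_crossing_mul hai hx' hxy, mul_assoc, mul_assoc, mul_assoc]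
  constructor
  · rw [mul_assoc, ← mul_assoc (crossing a⁻¹ _), hinv', one_mul, h.mul_inv]
  · rw [mul_assoc, ← mul_assoc r', h.inv_mul, one_mul, hinv]
  · exact fun i h1 h2 => h.sq i h1 (by omega)
  · intro i h1 h2
    rw [mul_assoc, ← (Commute.crossing_right (h.comm i (k + 1) h1 (by omega) le_rfl) _).eq,
      ← mul_assoc, h.shift i h1 (by omega), mul_assoc]
  · rw [htop, hss, ← mul_assoc, ← h.shift_top, mul_assoc (r * r) (e (k + 1)),
      mul_assoc (r * r) (e (k + 1)), ← mul_assoc (e (k + 1)),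
      mul_crossing_mul_crossing hai hy' (h.down k hk le_rfl)]
  · exact fun i h1 h2 => h.up i h1 (by omega)
  · exact fun i h1 h2 => h.down i h1 (by omega)
  · exact fun i j h1 h2 h3 => h.comm i j h1 h2 (by omega)
  · rw [htop, h.top]
    obtain ⟨j, rfl⟩ : ∃ j, k = j + 1 := ⟨k - 1, by omega⟩
    simp only [word, mul_assoc] at hxy ⊢
    rw [hxy]

/-- The last generator commutes with the image of the rotation two levels below. -/
lemma commute_restrict (hk : 1 ≤ k) (h : TLData a (k + 1) r r' e) :
    Commute (e (k + 1)) (r * crossing a⁻¹ (e (k + 1)) * crossing a⁻¹ (e k)) := by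
  have hai := inv_ne_zero ha
  have hx' : e k * e k = loop a⁻¹ • e k := by rw [loop_inv]; exact h.sq k hk (by omega)
  have hy' : e (k + 1) * e (k + 1) = loop a⁻¹ • e (k + 1) := by
    rw [loop_inv]; exact h.sq (k + 1) (by omega) le_rfl
  have h1 := mul_crossing_mul_crossing hai hx' (h.up k hk le_rfl)
  have h2 := crossing_mul_crossing_mul hai hy' (h.down k hk le_rfl)
  rw [Commute, SemiconjBy, ← mul_assoc, ← mul_assoc, ← h.shift k hk le_rfl, mul_assoc r,
    mul_assoc r, h1, mul_assoc r, mul_assoc r, h2]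

/-- The generators on two strands, from a Jones projection over the center `ℂ[z]` of the
algebra on one strand. -/
lemma ofJones {t t' ε z : C} (htt' : t * t' = 1) (ht't : t' * t = 1)
    (hz : z = a • t + a⁻¹ • t') (hsq : ε * ε = loop a • ε) (hcomm : Commute ε z)
    (hjones : ε * t * ε = (-a⁻¹ ^ 3) • (z * ε)) :
    TLData a 1 (t * crossing a ε) (crossing a⁻¹ ε * t') (fun _ => ε) := by
  have hai := inv_ne_zero ha
  have hsq' : ε * ε = loop a⁻¹ • ε := by rw [loop_inv]; exact hsq
  have hinv := crossing_mul_crossing_inv ha hsq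
  have hinv' := crossing_mul_crossing_inv hai hsq'
  rw [inv_inv] at hinv'
  have h1 : crossing a ε * t * ε = (-a⁻¹ ^ 3) • (t' * ε) := by
    rw [crossing, add_mul, add_mul, smul_mul_assoc, smul_mul_assoc, hjones, hz,
      Algebra.algebraMap_eq_smul_one]
    simp only [add_mul, smul_mul_assoc, one_mul]
    match_scalars <;> field_simp; ring
  have h2 : ε * t * crossing a ε = (-a⁻¹ ^ 3) • (ε * t') := by
    rw [crossing, mul_add, mul_smul_comm, hjones, ← hcomm.eq, hz,
      Algebra.algebraMap_eq_smul_one]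
    simp only [mul_add, mul_smul_comm, mul_one]
    match_scalars <;> field_simp; ring
  have hscal : (-a ^ 3) * (-a⁻¹ ^ 3) = (1 : ℂ) := by field_simp
  have hL : t * crossing a ε * (t * crossing a ε) * ε = ε := by
    calc t * crossing a ε * (t * crossing a ε) * ε
        = t * crossing a ε * t * (crossing a ε * ε) := by simp only [mul_assoc]
      _ = (-a ^ 3) • (t * (crossing a ε * t * ε)) := by
          rw [crossing_mul_self ha hsq, mul_smul_comm]; simp only [mul_assoc]
      _ = ε := by
          rw [h1, mul_smul_comm, smul_smul, hscal, one_smul, ← mul_assoc, htt', one_mul]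
  have hR : ε * (t * crossing a ε * (t * crossing a ε)) = ε := by
    calc ε * (t * crossing a ε * (t * crossing a ε))
        = ε * t * crossing a ε * t * crossing a ε := by simp only [mul_assoc]
      _ = (-a⁻¹ ^ 3) • (ε * (t' * t) * crossing a ε) := by
          rw [h2]; simp only [smul_mul_assoc, mul_assoc]
      _ = ε := by
          rw [ht't, mul_one, self_mul_crossing ha hsq, smul_smul, mul_comm, hscal, one_smul]
  constructor
  · rw [mul_assoc, ← mul_assoc (crossing a ε), hinv, one_mul, htt']
  · rw [mul_assoc, ← mul_assoc t', ht't, one_mul, hinv']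
  · exact fun _ _ _ => hsq
  · intro i h1 h2; omega
  · rw [hL, hR]
  · intro i h1 h2; omega
  · intro i h1 h2; omega
  · intro i j h1 h2 h3; omega
  · rw [hL, word, word, one_mul]

end TLData

end TLData

section Presentation

variable {t4 : ℂ} {n : ℕ}

lemma E_mul_self (i : ZMod n) : E t4 n i * E t4 n i = loop t4 • E t4 n i := by
  rw [E, ← map_mul, RingQuot.mkAlgHom_rel ℂ (TLrel.esq i), map_smul]

lemma R_mul_E (i : ZMod n) : R t4 n * E t4 n i = E t4 n (i + 1) * R t4 n := by
  rw [E, R, ← map_mul, RingQuot.mkAlgHom_rel ℂ (TLrel.rer i), map_mul]; rfl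

lemma R_mul_Ri : R t4 n * Ri t4 n = 1 := by
  rw [R, Ri, ← map_mul, RingQuot.mkAlgHom_rel ℂ TLrel.rri, map_one]

lemma Ri_mul_R : Ri t4 n * R t4 n = 1 := by
  rw [R, Ri, ← map_mul, RingQuot.mkAlgHom_rel ℂ TLrel.rir, map_one]

lemma E_commute (h : 3 ≤ n) {i j : ZMod n} (h1 : i - j ≠ 1) (h2 : i - j ≠ -1) :
    Commute (E t4 n i) (E t4 n j) := by
  rw [Commute, SemiconjBy, E, E, ← map_mul, RingQuot.mkAlgHom_rel ℂ (TLrel.comm h i j h1 h2),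
    map_mul]

lemma E_mul_E_add_one_mul_E (h : 3 ≤ n) (i : ZMod n) :
    E t4 n i * E t4 n (i + 1) * E t4 n i = E t4 n i := by
  rw [E, E, ← map_mul, ← map_mul, RingQuot.mkAlgHom_rel ℂ (TLrel.eplus h i)]

lemma E_mul_E_sub_one_mul_E (h : 3 ≤ n) (i : ZMod n) :
    E t4 n i * E t4 n (i - 1) * E t4 n i = E t4 n i := by
  rw [E, E, ← map_mul, ← map_mul, RingQuot.mkAlgHom_rel ℂ (TLrel.eminus h i)]

lemma R_mul_E_one_pow (h : 3 ≤ n) :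
    (R t4 n * E t4 n 1) ^ (n - 1) = R t4 n ^ n * (R t4 n * E t4 n 1) := by
  have := RingQuot.mkAlgHom_rel ℂ (TLrel.cyc (t4 := t4) h)
  simp only [map_mul, map_pow] at this
  exact this

lemma eq_of_mul_pow_eq {C : Type*} [Monoid C] {r r' x y : C} (h : r * r' = 1) (j : ℕ)
    (hxy : x * r ^ j = y * r ^ j) : x = y := by
  have hj : r ^ j * r' ^ j = 1 := by
    induction j with
    | zero => simp
    | succ j ih =>
      rw [pow_succ, pow_succ', mul_assoc, ← mul_assoc r, h, one_mul]
      exact ih (by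
        have := congrArg (· * r') hxy
        simpa only [pow_succ, mul_assoc, h, mul_one] using this)
  simpa only [mul_assoc, hj, mul_one] using congrArg (· * r' ^ j) hxy

lemma natCast_ne {k i j : ℕ} (h1 : i < j) (h2 : j < i + (k + 1)) :
    (i : ZMod (k + 1)) ≠ j := by
  rw [Ne, ZMod.natCast_eq_natCast_iff']
  intro h
  have := Nat.le_of_dvd (by omega) ((Nat.modEq_iff_dvd' h1.le).1 h)
  omega

/-- The word `(e_1 r)^k` in terms of `e_1 ⋯ e_k`. -/
lemma word_mul_pow {C : Type*} [Ring C] {r : C} {e : ℕ → C} (k : ℕ)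
    (h : ∀ i, 1 ≤ i → i + 1 ≤ k → r * e i = e (i + 1) * r) :
    (∀ j, j + 1 ≤ k → r ^ j * e 1 = e (j + 1) * r ^ j) ∧ word e k * r ^ k = (e 1 * r) ^ k := by
  have hpow : ∀ j, j + 1 ≤ k → r ^ j * e 1 = e (j + 1) * r ^ j := by
    intro j hj
    induction j with
    | zero => simp
    | succ j ih =>
      rw [pow_succ', mul_assoc, ih (by omega), ← mul_assoc, h _ (by omega) hj, mul_assoc]
  refine ⟨hpow, ?_⟩
  suffices ∀ j, j ≤ k → word e j * r ^ j = (e 1 * r) ^ j from this k le_rfl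
  intro j hj
  induction j with
  | zero => simp [word]
  | succ j ih =>
    rw [word, pow_succ r, mul_assoc, ← mul_assoc (e (j + 1)), ← hpow j hj, mul_assoc (r ^ j),
      ← mul_assoc (word e j), ih (by omega), pow_succ]

lemma tlData (t4 : ℂ) {k : ℕ} (hk : 1 ≤ k) :
    TLData t4 k (R t4 (k + 1)) (Ri t4 (k + 1)) (fun i => E t4 (k + 1) (i : ZMod (k + 1))) := by
  have hshift : ∀ i : ℕ, R t4 (k + 1) * E t4 (k + 1) (i : ZMod (k + 1)) =
      E t4 (k + 1) ((i + 1 : ℕ) : ZMod (k + 1)) * R t4 (k + 1) := fun i => by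
    rw [R_mul_E, Nat.cast_succ]
  have hself : ((k + 1 : ℕ) : ZMod (k + 1)) = 0 := ZMod.natCast_self _
  constructor
  · exact R_mul_Ri
  · exact Ri_mul_R
  · exact fun i _ _ => E_mul_self _
  · exact fun i _ _ => hshift i
  · rw [mul_assoc, hshift, ← mul_assoc, hshift, mul_assoc]
    congr 2
    rw [Nat.cast_succ, hself, zero_add, Nat.cast_one]
  · intro i h1 h2
    simpa using E_mul_E_add_one_mul_E (t4 := t4) (n := k + 1) (by omega) (i : ZMod (k + 1))
  · intro i h1 h2
    simpa using E_mul_E_sub_one_mul_E (t4 := t4) (n := k + 1) (by omega)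
      ((i + 1 : ℕ) : ZMod (k + 1))
  · intro i j h1 h2 h3
    refine E_commute (by omega) (fun h => ?_) (fun h => ?_)
    · refine natCast_ne (k := k) (i := i) (j := j + 1) (by omega) (by omega) ?_
      rw [Nat.cast_succ, sub_eq_iff_eq_add.1 h]; ring
    · refine natCast_ne (k := k) (i := i + 1) (j := j) (by omega) (by omega) ?_
      rw [Nat.cast_succ, sub_eq_iff_eq_add.1 h]; ring
  · rcases Nat.lt_or_ge 1 k with hk' | hk'
    · refine eq_of_mul_pow_eq R_mul_Ri k ?_
      have hw := word_mul_pow (r := R t4 (k + 1))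
        (e := fun i => E t4 (k + 1) (i : ZMod (k + 1))) k (fun i _ _ => hshift i)
      obtain ⟨j, rfl⟩ : ∃ j, k = j + 1 := ⟨k - 1, by omega⟩
      have hc := R_mul_E_one_pow (t4 := t4) (n := j + 1 + 1) (by omega)
      have h1 := hw.1 j le_rfl
      rw [hw.2]
      rw [Nat.add_sub_cancel] at hc
      simp only [Nat.cast_one] at h1 ⊢
      have key : R t4 (j + 1 + 1) * (E t4 (j + 1 + 1) 1 * R t4 (j + 1 + 1)) ^ (j + 1) =
          (R t4 (j + 1 + 1) * E t4 (j + 1 + 1) 1) ^ (j + 1) * R t4 (j + 1 + 1) := by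
        rw [mul_pow_mul]
      rw [hc] at key
      have := congrArg (Ri t4 (j + 1 + 1) * ·) key
      simp only [← mul_assoc, Ri_mul_R, one_mul] at this
      rw [this, pow_succ _ j, ← mul_assoc, mul_assoc (_ * _) (E _ _ _), ← h1,
        pow_succ' _ (j + 1), pow_succ' _ j]
      simp only [← mul_assoc, Ri_mul_R, one_mul]
      simp only [mul_assoc]
      simp only [← mul_assoc, ← pow_succ']
      simp only [← pow_succ]
    · obtain rfl : k = 1 := by omega
      have := RingQuot.mkAlgHom_rel ℂ (TLrel.two (t4 := t4) rfl)
      simp only [map_mul] at this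
      simpa [word, R, E] using this

lemma adjoin_eq_top (k : ℕ) :
    Algebra.adjoin ℂ {R t4 (k + 1), Ri t4 (k + 1), E t4 (k + 1) 1} = ⊤ := by
  set S := Algebra.adjoin ℂ {R t4 (k + 1), Ri t4 (k + 1), E t4 (k + 1) 1} with hS
  have hR : R t4 (k + 1) ∈ S := Algebra.subset_adjoin (by simp)
  have hRi : Ri t4 (k + 1) ∈ S := Algebra.subset_adjoin (by simp)
  have hE1 : E t4 (k + 1) 1 ∈ S := Algebra.subset_adjoin (by simp)
  have hE : ∀ j : ℕ, E t4 (k + 1) (j + 1) ∈ S := by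
    intro j
    induction j with
    | zero => simpa using hE1
    | succ j ih =>
      have : R t4 (k + 1) * E t4 (k + 1) (j + 1) * Ri t4 (k + 1) =
          E t4 (k + 1) ((j + 1 : ℕ) + 1) := by
        rw [R_mul_E, mul_assoc, R_mul_Ri, mul_one, Nat.cast_succ]
      exact this ▸ mul_mem (mul_mem hR ih) hRi
  rw [eq_top_iff]
  rintro x -
  obtain ⟨y, rfl⟩ := RingQuot.mkAlgHom_surjective ℂ (TLrel t4 (k + 1)) x
  have hy : y ∈ Algebra.adjoin ℂ (Set.range (FreeAlgebra.ι ℂ (X := TLgen (k + 1)))) := by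
    rw [FreeAlgebra.adjoin_range_ι]; exact Algebra.mem_top
  induction hy using Algebra.adjoin_induction with
  | mem y hy =>
    rcases hy with ⟨i | _ | _, rfl⟩
    · have := hE (i - 1).val
      rwa [ZMod.natCast_zmod_val, sub_add_cancel] at this
    · exact hR
    · exact hRi
  | algebraMap c => rw [AlgHom.commutes]; exact algebraMap_mem _ _
  | add x y _ _ hx hy => rw [map_add]; exact add_mem hx hy
  | mul x y _ _ hx hy => rw [map_mul]; exact mul_mem hx hy

end Presentation

section Lift

variable {C : Type*} [Ring C] [Algebra ℂ C]

/-- Conjugation by `r`, whose inverse is `r'`. -/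
def conj {r r' : C} (h : r' * r = 1) (h' : r * r' = 1) : C →ₐ[ℂ] C where
  toFun x := r * x * r'
  map_one' := by rw [mul_one, h']
  map_mul' x y := by
    simp only [mul_assoc]
    rw [← mul_assoc r' r, h, one_mul]
  map_zero' := by simp
  map_add' x y := by simp [mul_add, add_mul]
  commutes' c := by rw [← Algebra.commutes, mul_assoc, h', mul_one]

lemma TLData.exists_algHom {a : ℂ} {k : ℕ} (hk : 1 ≤ k) {r r' : C} {e : ℕ → C}
    (h : TLData a k r r' e) :
    ∃ F : TL a (k + 1) →ₐ[ℂ] C, F (R a (k + 1)) = r ∧ F (Ri a (k + 1)) = r' ∧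
      ∀ i : ℕ, 1 ≤ i → i ≤ k → F (E a (k + 1) (i : ZMod (k + 1))) = e i := by
  set c := conj h.inv_mul h.mul_inv with hc
  have hcr : ∀ x, r * x = c x * r := fun x => by
    simp [hc, conj, mul_assoc, h.inv_mul]
  have hcr' : ∀ x y, r * x = y * r → c x = y := fun x y hxy => by
    change r * x * r' = y
    rw [hxy, mul_assoc, h.mul_inv, mul_one]
  set x : ℕ → C := fun j => (c ^ j) (e 1) with hx
  have hadd : ∀ p d, x (p + d) = (c ^ p) (x d) := fun p d => by
    simp only [hx, pow_add, AlgHom.mul_apply]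
  have hxe : ∀ j, j + 1 ≤ k → x j = e (j + 1) := by
    intro j hj
    induction j with
    | zero => simp [hx]
    | succ j ih =>
      rw [add_comm, hadd, ih (by omega), pow_one, add_comm 1 j]
      exact hcr' _ _ (h.shift _ (by omega) hj)
  have hper : Function.Periodic x (k + 1) := by
    intro j
    rw [hadd]
    have : x (k + 1) = x 0 := by
      obtain ⟨l, rfl⟩ : ∃ l, k = l + 1 := ⟨k - 1, by omega⟩
      rw [show l + 1 + 1 = 2 + l by ring, hadd, hxe l le_rfl, pow_two, AlgHom.mul_apply,
        hxe 0 (by omega)]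
      simp only [hc, conj, AlgHom.coe_mk, RingHom.coe_mk, MonoidHom.coe_mk, OneHom.coe_mk]
      have := h.shift_top
      simp only [← mul_assoc] at this ⊢
      rw [this]
      rw [mul_assoc _ r r', h.mul_inv, mul_one, mul_assoc, h.mul_inv, mul_one]
    rw [this, ← hadd, add_zero]
  let f : ZMod (k + 1) → C := fun i => x (i - 1).val
  have hf : ∀ j : ℕ, f (j + 1) = x j := fun j => by
    simp only [f, add_sub_cancel_right, ZMod.val_natCast, hper.map_mod_nat]
  have hsurj : ∀ i : ZMod (k + 1), ∃ j : ℕ, j < k + 1 ∧ i = j + 1 := fun i =>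
    ⟨(i - 1).val, ZMod.val_lt _, by rw [ZMod.natCast_zmod_val, sub_add_cancel]⟩
  have hx0 : x 0 = e 1 := hxe 0 hk
  have hzero : ∀ j, x j = (c ^ j) (e 1) := fun j => rfl
  have hsq : ∀ j, x j * x j = loop a • x j := fun j => by
    rw [hzero, ← map_mul, h.sq 1 le_rfl hk, map_smul]
  let g : TLgen (k + 1) → C := fun y => match y with
    | .e i => f i
    | .r => r
    | .ri => r'
  have hg : ∀ y z : FA (k + 1), TLrel a (k + 1) y z →
      FreeAlgebra.lift ℂ g y = FreeAlgebra.lift ℂ g z := by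
    have he : ∀ i, FreeAlgebra.lift ℂ g (ef (k + 1) i) = f i := fun i => by simp [ef, g]
    have hr : FreeAlgebra.lift ℂ g (rf (k + 1)) = r := by simp [rf, g]
    have hri : FreeAlgebra.lift ℂ g (rif (k + 1)) = r' := by simp [rif, g]
    rintro _ _ (i | i | _ | _ | ⟨h3, i, j, h1, h2⟩ | ⟨h3, i⟩ | ⟨h3, i⟩ | h3 | h2)
    · obtain ⟨j, -, rfl⟩ := hsurj i
      rw [map_mul, map_smul, he, hf, hsq]
    · obtain ⟨j, -, rfl⟩ := hsurj i
      rw [map_mul, map_mul, he, he, hf, hr, hcr, ← Nat.cast_succ, hf, Nat.succ_eq_add_one,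
        add_comm j, hadd, pow_one]
    · rw [map_mul, map_one, hr, hri, h.mul_inv]
    · rw [map_mul, map_one, hr, hri, h.inv_mul]
    · rw [map_mul, map_mul, he, he]
      change Commute (f i) (f j)
      have key : ∀ p q : ℕ, p ≤ q → q < k + 1 → (q : ZMod (k + 1)) - p ≠ 1 →
          (p : ZMod (k + 1)) - q ≠ 1 → Commute (x p) (x q) := by
        intro p q hpq hq h1 h2
        obtain ⟨d, rfl⟩ := Nat.exists_eq_add_of_le hpq
        have hd1 : d ≠ 1 := by rintro rfl; simp at h1
        have hdk : d ≠ k := by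
          rintro rfl
          apply h2
          have : ((d + 1 : ℕ) : ZMod (d + 1)) = 0 := ZMod.natCast_self _
          rw [Nat.cast_add, sub_eq_iff_eq_add, add_left_comm, add_comm 1, ← Nat.cast_succ, this,
            add_zero]
        rw [hadd, hzero p]
        refine Commute.map ?_ _
        rcases Nat.eq_zero_or_pos d with rfl | hd
        · exact Commute.refl _
        · rw [hxe d (by omega)]
          exact h.comm 1 (d + 1) le_rfl (by omega) (by omega)
      obtain ⟨p, hp, rfl⟩ := hsurj i
      obtain ⟨q, hq, rfl⟩ := hsurj j
      rw [add_sub_add_right_eq_sub] at h1 h2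
      rw [Ne, ← neg_inj, neg_neg, neg_sub] at h2
      rw [hf, hf]
      rcases le_total p q with hpq | hpq
      · exact key p q hpq hq h2 h1
      · exact (key q p hpq hp h1 h2).symm
    · obtain ⟨j, -, rfl⟩ := hsurj i
      rw [map_mul, map_mul, he, he, hf, ← Nat.cast_succ, hf, Nat.succ_eq_add_one, hadd,
        hzero j, ← map_mul, ← map_mul, hxe 1 (by omega), h.up 1 le_rfl (by omega)]
    · obtain ⟨j, -, hj⟩ := hsurj (i - 1)
      obtain rfl : i = (j + 1 : ℕ) + 1 := by rw [Nat.cast_succ, ← hj, sub_add_cancel]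
      rw [map_mul, map_mul, he, he, hj, hf, hf, hadd, hzero j,
        ← map_mul, ← map_mul, hxe 1 (by omega), h.down 1 le_rfl (by omega)]
    · rw [map_pow, map_mul, map_mul, map_pow, map_mul, he, hr]
      have hf1 : f 1 = e 1 := by simpa [hx0] using hf 0
      rw [hf1, Nat.add_sub_cancel]
      obtain ⟨l, rfl⟩ : ∃ l, k = l + 1 := ⟨k - 1, by omega⟩
      obtain ⟨hw1, hw2⟩ := word_mul_pow (l + 1) h.shift
      refine eq_of_mul_pow_eq h.mul_inv 1 ?_
      rw [pow_one, mul_pow_mul, ← hw2, ← h.top, pow_succ r l, mul_assoc (r * r),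
        ← mul_assoc (e (l + 1)), ← hw1 l le_rfl, pow_succ r (l + 1), pow_succ' r l]
      have hl : ∀ y, r ^ l * (r * y) = r * (r ^ l * y) := fun y => by
        rw [← mul_assoc, (Commute.pow_self r l).eq, mul_assoc]
      simp only [mul_assoc, hl]
    · obtain rfl : k = 1 := by omega
      have hf1 : f 1 = e 1 := by simpa [hx0] using hf 0
      rw [map_mul, map_mul, he, hr, hf1, h.top, word, word, one_mul]
  refine ⟨RingQuot.liftAlgHom ℂ ⟨FreeAlgebra.lift ℂ g, hg⟩, ?_, ?_, fun i h1 h2 => ?_⟩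
  · simp [R, rf, g]
  · simp [Ri, rif, g]
  · obtain ⟨j, rfl⟩ : ∃ j, i = j + 1 := ⟨i - 1, by omega⟩
    simp only [E, ef, RingQuot.liftAlgHom_mkAlgHom_apply, FreeAlgebra.lift_ι_apply, g]
    rw [Nat.cast_succ, hf, hxe j h2]

end Lift

section Tower

open basicDual

variable {a : ℂ}

/-- The generator `e_i` of `TL_{k+1}`, indexed by a natural number. -/
def gen (a : ℂ) (k i : ℕ) : TL a (k + 1) := E a (k + 1) (i : ZMod (k + 1))

lemma gen_one (a : ℂ) (k : ℕ) : gen a k 1 = E a (k + 1) 1 := by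
  rw [gen, Nat.cast_one]

lemma tlData_gen (a : ℂ) {k : ℕ} (hk : 1 ≤ k) :
    TLData a k (R a (k + 1)) (Ri a (k + 1)) (gen a k) := tlData a hk

/-- The image of `TL_k` in `TL_{k+1}`. -/
def lower (a : ℂ) (k : ℕ) : Subalgebra ℂ (TL a (k + 1)) :=
  Algebra.adjoin ℂ ({R a (k + 1) * crossing a⁻¹ (gen a k k),
    crossing a (gen a k k) * Ri a (k + 1)} ∪ {x | ∃ i, 1 ≤ i ∧ i + 1 ≤ k ∧ x = gen a k i})

lemma R_crossing_mem_lower (a : ℂ) (k : ℕ) :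
    R a (k + 1) * crossing a⁻¹ (gen a k k) ∈ lower a k :=
  Algebra.subset_adjoin (Or.inl (Or.inl rfl))

lemma crossing_Ri_mem_lower (a : ℂ) (k : ℕ) :
    crossing a (gen a k k) * Ri a (k + 1) ∈ lower a k :=
  Algebra.subset_adjoin (Or.inl (Or.inr rfl))

lemma gen_mem_lower (a : ℂ) {k i : ℕ} (h1 : 1 ≤ i) (h2 : i + 1 ≤ k) : gen a k i ∈ lower a k :=
  Algebra.subset_adjoin (Or.inr ⟨i, h1, h2, rfl⟩)

lemma lower_le {k : ℕ} {S : Subalgebra ℂ (TL a (k + 1))}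
    (hR : R a (k + 1) * crossing a⁻¹ (gen a k k) ∈ S)
    (hRi : crossing a (gen a k k) * Ri a (k + 1) ∈ S)
    (hgen : ∀ i, 1 ≤ i → i + 1 ≤ k → gen a k i ∈ S) : lower a k ≤ S := by
  refine Algebra.adjoin_le ?_
  rintro _ ((rfl | rfl) | ⟨i, h1, h2, rfl⟩)
  exacts [hR, hRi, hgen i h1 h2]

/-- `TL_{k+1}` carries a conditional expectation onto `TL_k` whose Jones projection is the last
generator. -/
def HasExpectation (a : ℂ) (k : ℕ) : Prop :=
  ∃ π : TL a (k + 1) →ₗ[ℂ] TL a (k + 1),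
    IsExpectation (loop a) (lower a k) π (gen a k k) ∧ π (gen a k k) = 1 ∧
      ∀ p : TL a (k + 1) → Prop, (∀ x y, p x → p y → p (x + y)) → (∀ b ∈ lower a k, p b) →
        (∀ b ∈ lower a k, ∀ c ∈ lower a k, p (b * gen a k k * c)) → ∀ y, p y

/-- The arc insertion `TL_{k+1} → TL_{k+2}` on the generators `ρ`, `ρ⁻¹` and `e_1, …, e_k`. -/
structure IsInsertion (a : ℂ) (k : ℕ) (I : TL a (k + 1) →ₐ[ℂ] TL a (k + 1 + 1)) : Prop where
  map_R : I (R a (k + 1)) = R a (k + 1 + 1) * crossing a⁻¹ (gen a (k + 1) (k + 1))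
  map_Ri : I (Ri a (k + 1)) = crossing a (gen a (k + 1) (k + 1)) * Ri a (k + 1 + 1)
  map_gen : ∀ i, 1 ≤ i → i ≤ k → I (gen a k i) = gen a (k + 1) i

lemma IsJonesExtension.hasExpectation {A : Type*} [Ring A] [Algebra ℂ A] {B : Subalgebra ℂ A}
    {π : A →ₗ[ℂ] A} {e : A} {h : IsExpectation (loop a) B π e} {k : ℕ}
    {I : A →ₐ[ℂ] TL a (k + 1)} {Φ : TL a (k + 1) →ₐ[ℂ] Module.End ℂ (basicDual B e)}
    (hJ : IsJonesExtension h I (gen a k k) Φ) (hI : I.range = lower a k) :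
    HasExpectation a k := by
  refine ⟨I.toLinearMap ∘ₗ toBase Φ h, hI ▸ hJ.isExpectation, ?_, fun p add base proj y => ?_⟩
  · change I (toBase Φ h (gen a k k)) = 1
    rw [hJ.toBase_proj, map_one]
  · rw [← hI] at base proj
    exact hJ.span_induction add (fun x => base _ ⟨x, rfl⟩)
      (fun x y => proj _ ⟨x, rfl⟩ _ ⟨y, rfl⟩) y

lemma algHom_ext {C : Type*} [Ring C] [Algebra ℂ C] {k : ℕ} {f g : TL a (k + 1) →ₐ[ℂ] C}
    (hR : f (R a (k + 1)) = g (R a (k + 1))) (hRi : f (Ri a (k + 1)) = g (Ri a (k + 1)))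
    (hgen : f (gen a k 1) = g (gen a k 1)) : f = g := by
  rw [gen_one] at hgen
  refine AlgHom.ext_of_adjoin_eq_top (adjoin_eq_top k) ?_
  rintro _ (rfl | rfl | rfl)
  exacts [hR, hRi, hgen]

lemma IsInsertion.range_eq {k : ℕ} (hk : 1 ≤ k) {I : TL a (k + 1) →ₐ[ℂ] TL a (k + 1 + 1)}
    (hI : IsInsertion a k I) : I.range = lower a (k + 1) := by
  refine le_antisymm ?_ (lower_le ⟨_, hI.map_R⟩ ⟨_, hI.map_Ri⟩
    fun i h1 h2 => ⟨_, hI.map_gen i h1 (by omega)⟩)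
  rw [← Algebra.map_top, ← adjoin_eq_top k, AlgHom.map_adjoin]
  refine Algebra.adjoin_le ?_
  rintro _ ⟨_, rfl | rfl | rfl, rfl⟩
  · exact hI.map_R ▸ R_crossing_mem_lower a (k + 1)
  · exact hI.map_Ri ▸ crossing_Ri_mem_lower a (k + 1)
  · rw [← gen_one, SetLike.mem_coe, hI.map_gen 1 le_rfl hk]
    exact gen_mem_lower a le_rfl (by omega)

lemma commute_of_mul_eq_one {M : Type*} [Monoid M] {x u v : M} (huv : u * v = 1)
    (hvu : v * u = 1) (h : Commute x u) : Commute x v := by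
  calc x * v = v * (u * x) * v := by rw [← mul_assoc, hvu, one_mul]
    _ = v * x * (u * v) := by rw [← h.eq]; simp only [mul_assoc]
    _ = v * x := by rw [huv, mul_one]

variable (ha : a ≠ 0) {k : ℕ} (hk : 1 ≤ k)
include ha hk

lemma exists_isInsertion : ∃ I, IsInsertion a k I := by
  obtain ⟨I, hR, hRi, hgen⟩ :=
    ((tlData_gen a (k := k + 1) (by omega)).restrict ha hk).exists_algHom hk
  exact ⟨I, hR, hRi, hgen⟩

/-- The algebra generated by the basic construction over `TLData` on `k + 1` strands is a quotient
of `TL_{k+2}`. -/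
lemma IsExpectation.exists_algHom {A : Type*} [Ring A] [Algebra ℂ A] {B : Subalgebra ℂ A}
    {π : A →ₗ[ℂ] A} {r r' : A} {e : ℕ → A} (h : IsExpectation (loop a) B π (e k))
    (hD : TLData a k r r' e) (h1 : π (e k) = 1) (hr : r * crossing a⁻¹ (e k) ∈ B)
    (he : ∀ i, 1 ≤ i → i + 1 ≤ k → e i ∈ B) :
    ∃ Φ : TL a (k + 1 + 1) →ₐ[ℂ] Module.End ℂ (basicDual B (e k)),
      Φ (R a (k + 1 + 1) * crossing a⁻¹ (gen a (k + 1) (k + 1))) = act B (e k) r ∧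
      Φ (crossing a (gen a (k + 1) (k + 1)) * Ri a (k + 1 + 1)) = act B (e k) r' ∧
      Φ (gen a (k + 1) (k + 1)) = jones h ∧
      ∀ i, 1 ≤ i → i ≤ k → Φ (gen a (k + 1) i) = act B (e k) (e i) := by
  have hext := (hD.map (act B (e k))).extend ha hk (ε := jones h) (jones_mul_jones h)
    (act_mul_jones_mul_act h) (jones_mul_act_self_mul_jones h h1)
    (by
      rw [← map_crossing, ← map_mul]
      exact jones_mul_act h hr)
    fun i h1 h2 => jones_mul_act h (he i h1 h2)
  obtain ⟨Φ, hΦR, hΦRi, hΦgen⟩ := hext.exists_algHom (by omega)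
  have hΦe : Φ (gen a (k + 1) (k + 1)) = jones h := by
    rw [gen, hΦgen _ (by omega) le_rfl, Function.update_self]
  have hinv := crossing_mul_crossing_inv ha (jones_mul_jones h)
  refine ⟨Φ, ?_, ?_, hΦe, fun i h1 h2 => ?_⟩
  · rw [map_mul, map_crossing, hΦR, hΦe, mul_assoc, hinv, mul_one]
  · rw [map_mul, map_crossing, hΦRi, hΦe, ← mul_assoc, hinv, one_mul]
  · rw [gen, hΦgen i h1 (by omega), Function.update_of_ne (by omega)]

lemma IsInsertion.exists_isJonesExtension {I : TL a (k + 1) →ₐ[ℂ] TL a (k + 1 + 1)}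
    (hI : IsInsertion a k I) {π : TL a (k + 1) →ₗ[ℂ] TL a (k + 1)}
    (h : IsExpectation (loop a) (lower a k) π (gen a k k)) (h1 : π (gen a k k) = 1)
    (hspan : ∀ p : TL a (k + 1) → Prop, (∀ x y, p x → p y → p (x + y)) →
      (∀ b ∈ lower a k, p b) →
        (∀ b ∈ lower a k, ∀ c ∈ lower a k, p (b * gen a k k * c)) → ∀ y, p y) :
    ∃ Φ, IsJonesExtension h I (gen a (k + 1) (k + 1)) Φ := by
  have hD := tlData_gen a hk
  have hD' := tlData_gen a (k := k + 1) (by omega)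
  have hai := inv_ne_zero ha
  have inv_left : ∀ {C : Type} [Ring C] [Algebra ℂ C] {x : C}, x * x = loop a • x →
      crossing a⁻¹ x * crossing a x = 1 := fun hx => by
    rw [← loop_inv] at hx
    simpa using crossing_mul_crossing_inv hai hx
  have hsq := hD'.sq (k + 1) (by omega) le_rfl
  have hinv := crossing_mul_crossing_inv ha hsq
  have hinv' := inv_left hsq
  obtain ⟨Φ, hΦR, hΦRi, hΦe, hΦgen⟩ := h.exists_algHom ha hk hD h1
    (R_crossing_mem_lower a k) (fun i h1 h2 => gen_mem_lower a h1 h2)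
  have hcomm : ∀ b ∈ lower a k, Commute (gen a (k + 1) (k + 1)) (I b) := by
    have hle : lower a k ≤ (Subalgebra.centralizer ℂ {gen a (k + 1) (k + 1)}).comap I := by
      have hR : Commute (gen a (k + 1) (k + 1)) (I (R a (k + 1) * crossing a⁻¹ (gen a k k))) := by
        rw [map_mul, map_crossing, hI.map_R, hI.map_gen k hk le_rfl]
        exact hD'.commute_restrict ha hk
      have hs := hD.sq k hk le_rfl
      refine lower_le ?_ ?_ ?_ <;>
        simp only [Subalgebra.mem_comap, Subalgebra.mem_centralizer_iff, Set.mem_singleton_iff,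
          forall_eq]
      · exact hR
      · refine commute_of_mul_eq_one ?_ ?_ hR
        · rw [← map_mul, mul_assoc, ← mul_assoc (crossing _ _) (crossing _ _), inv_left hs,
            one_mul, hD.mul_inv, map_one]
        · rw [← map_mul, mul_assoc, ← mul_assoc (Ri _ _), hD.inv_mul, one_mul,
            crossing_mul_crossing_inv ha hs, map_one]
      · intro i h1 h2
        rw [hI.map_gen i h1 (by omega)]
        exact (hD'.comm i (k + 1) h1 (by omega) le_rfl).symm
    intro b hb
    simpa [Subalgebra.mem_centralizer_iff, Commute, SemiconjBy] using hle hb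
  refine ⟨Φ, ?_, hΦe, ?_, hsq, hcomm, ?_⟩
  · suffices Φ.comp I = act (lower a k) (gen a k k) from fun x => DFunLike.congr_fun this x
    refine algHom_ext ?_ ?_ ?_ <;> rw [AlgHom.comp_apply]
    · rw [hI.map_R, hΦR]
    · rw [hI.map_Ri, hΦRi]
    · rw [hI.map_gen 1 le_rfl hk, hΦgen 1 le_rfl hk]
  · rw [eq_top_iff, ← adjoin_eq_top (k + 1)]
    refine Algebra.adjoin_le ?_
    set S := Algebra.adjoin ℂ (Set.range I ∪ {gen a (k + 1) (k + 1)})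
    have hIS : ∀ x, I x ∈ S := fun x => Algebra.subset_adjoin (Or.inl ⟨x, rfl⟩)
    have hcS : ∀ b, crossing b (gen a (k + 1) (k + 1)) ∈ S := fun b =>
      add_mem (S.smul_mem (Algebra.subset_adjoin (Or.inr rfl)) _) (algebraMap_mem _ _)
    rintro _ (rfl | rfl | rfl)
    · have := mul_mem (hIS (R a (k + 1))) (hcS a)
      rwa [hI.map_R, mul_assoc, hinv', mul_one] at this
    · have := mul_mem (hcS a⁻¹) (hIS (Ri a (k + 1)))
      rwa [hI.map_Ri, ← mul_assoc, hinv', one_mul] at this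
    · rw [← gen_one, ← hI.map_gen 1 le_rfl hk]
      exact hIS _
  · refine hspan _ ?_ ?_ ?_
    · intro x y hx hy
      simp only [map_add, mul_add, add_mul, hx, hy]
    · intro b hb
      have := h.left b hb 1
      rw [mul_one, h.one] at this
      rw [this, (hcomm b hb).eq, mul_assoc, hsq]
      simp
    · intro b hb c hc
      rw [h.right c hc, h.left b hb, h1, mul_one, map_mul, map_mul, map_mul,
        hI.map_gen k hk le_rfl]
      calc gen a (k + 1) (k + 1) * (I b * gen a (k + 1) k * I c) * gen a (k + 1) (k + 1)
          = gen a (k + 1) (k + 1) * I b * gen a (k + 1) k * (I c * gen a (k + 1) (k + 1)) := by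
            simp only [mul_assoc]
        _ = I b * (gen a (k + 1) (k + 1) * gen a (k + 1) k * gen a (k + 1) (k + 1)) * I c := by
            rw [(hcomm b hb).eq, ← (hcomm c hc).eq]; simp only [mul_assoc]
        _ = I b * I c * gen a (k + 1) (k + 1) := by
            rw [hD'.down k hk le_rfl, mul_assoc, (hcomm c hc).eq, mul_assoc]

lemma HasExpectation.injective (h : HasExpectation a k)
    {I : TL a (k + 1) →ₐ[ℂ] TL a (k + 1 + 1)} (hI : IsInsertion a k I) :
    Function.Injective I := by
  obtain ⟨π, h, h1, hspan⟩ := h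
  obtain ⟨Φ, hJ⟩ := hI.exists_isJonesExtension ha hk h h1 hspan
  exact hJ.injective

lemma HasExpectation.succ (h : HasExpectation a k) : HasExpectation a (k + 1) := by
  obtain ⟨π, h, h1, hspan⟩ := h
  obtain ⟨I, hI⟩ := exists_isInsertion ha hk
  obtain ⟨Φ, hJ⟩ := hI.exists_isJonesExtension ha hk h h1 hspan
  exact hJ.hasExpectation (hI.range_eq hk)

end Tower

section Laurent

open basicDual LaurentPolynomial

/-- The generator of the image of the ground ring of the annulus in `TL_1 = ℂ[ρ, ρ⁻¹]`. -/
def core (a : ℂ) : LaurentPolynomial ℂ := a • T 1 + a⁻¹ • T (-1)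

/-- The Chebyshev polynomials of the second kind evaluated at `core a`. -/
def chebyshevCore (a : ℂ) (k : ℤ) : LaurentPolynomial ℂ :=
  Polynomial.aeval (core a) (Polynomial.Chebyshev.S ℂ k)

lemma core_mul_chebyshevCore (a : ℂ) (k : ℤ) :
    core a * chebyshevCore a k = chebyshevCore a (k + 1) + chebyshevCore a (k - 1) := by
  have := Polynomial.Chebyshev.S_add_one ℂ k
  simp [chebyshevCore, this]

/-- The conditional expectation of `TL_1` onto `ℂ[core a]`. -/
def laurentExpectation (a : ℂ) : LaurentPolynomial ℂ →ₗ[ℂ] LaurentPolynomial ℂ :=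
  Finsupp.linearCombination ℂ (fun k : ℤ =>
      a⁻¹ ^ k • (-a⁻¹ ^ 2 • chebyshevCore a k + a ^ 2 • chebyshevCore a (k - 2))) ∘ₗ
    (AddMonoidAlgebra.coeffLinearEquiv ℂ).toLinearMap

lemma laurentExpectation_T (a : ℂ) (k : ℤ) :
    laurentExpectation a (T k) =
      a⁻¹ ^ k • (-a⁻¹ ^ 2 • chebyshevCore a k + a ^ 2 • chebyshevCore a (k - 2)) := by
  simp [laurentExpectation, T, -single_eq_C_mul_T]

lemma laurentExpectation_one (a : ℂ) : laurentExpectation a 1 = loop a • 1 := by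
  rw [← T_zero, laurentExpectation_T]
  simp [chebyshevCore, loop]
  module

lemma laurentExpectation_T_one (a : ℂ) :
    laurentExpectation a (T 1) = (-a⁻¹ ^ 3) • core a := by
  rw [laurentExpectation_T]
  simp [chebyshevCore]
  module

lemma core_mul_T (a : ℂ) (k : ℤ) : core a * T k = a • T (k + 1) + a⁻¹ • T (k - 1) := by
  rw [core, add_mul, smul_mul_assoc, smul_mul_assoc, ← T_add, ← T_add, add_comm 1 k,
    neg_add_eq_sub]

lemma linearMap_induction {V : Type*} [AddCommGroup V] [Module ℂ V]
    {f g : LaurentPolynomial ℂ →ₗ[ℂ] V} (h : ∀ k, f (T k) = g (T k)) : f = g := by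
  refine LinearMap.ext fun x => ?_
  induction x using LaurentPolynomial.induction_on' with
  | add p q hp hq => rw [map_add, map_add, hp, hq]
  | C_mul_T n c => rw [← smul_eq_C_mul, map_smul, map_smul, h]

/-- The arc insertion `TL_1 → TL_2`. -/
structure IsInsertionOne (a : ℂ) (I : LaurentPolynomial ℂ →ₐ[ℂ] TL a (1 + 1)) : Prop where
  map_T : I (T 1) = R a (1 + 1) * crossing a⁻¹ (gen a 1 1)
  map_T_neg : I (T (-1)) = crossing a (gen a 1 1) * Ri a (1 + 1)

variable {a : ℂ}

lemma IsInsertionOne.range_eq {I : LaurentPolynomial ℂ →ₐ[ℂ] TL a (1 + 1)}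
    (hI : IsInsertionOne a I) : I.range = lower a 1 := by
  refine le_antisymm ?_ (lower_le ⟨_, hI.map_T⟩ ⟨_, hI.map_T_neg⟩ fun i h1 h2 => by omega)
  rintro _ ⟨x, rfl⟩
  change I x ∈ _
  induction x using LaurentPolynomial.induction_on with
  | h_C c => exact I.commutes c ▸ algebraMap_mem _ c
  | h_add hp hq => rw [map_add]; exact add_mem hp hq
  | h_C_mul_T n c h =>
    rw [T_add, ← mul_assoc, map_mul, hI.map_T]
    exact mul_mem h (R_crossing_mem_lower a 1)
  | h_C_mul_T_Z n c h =>
    rw [sub_eq_add_neg, T_add, ← mul_assoc, map_mul, hI.map_T_neg]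
    exact mul_mem h (crossing_Ri_mem_lower a 1)

variable (ha : a ≠ 0)
include ha

lemma laurentExpectation_core_mul (x : LaurentPolynomial ℂ) :
    laurentExpectation a (core a * x) = core a * laurentExpectation a x := by
  suffices laurentExpectation a ∘ₗ LinearMap.mulLeft ℂ (core a) =
      LinearMap.mulLeft ℂ (core a) ∘ₗ laurentExpectation a from LinearMap.congr_fun this x
  refine linearMap_induction fun k => ?_
  simp only [LinearMap.comp_apply, LinearMap.mulLeft_apply, core_mul_T, map_add, map_smul,
    laurentExpectation_T, core_mul_chebyshevCore,
    zpow_add₀ (inv_ne_zero ha), zpow_sub₀ (inv_ne_zero ha), zpow_one,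
    show k + 1 - 2 = k - 2 + 1 by ring, show k - 1 - 2 = k - 2 - 1 by ring]
  match_scalars <;> field_simp

lemma isExpectation_laurent :
    IsExpectation (loop a) (Algebra.adjoin ℂ {core a}) (laurentExpectation a) 0 := by
  have hleft : ∀ b ∈ Algebra.adjoin ℂ {core a}, ∀ x,
      laurentExpectation a (b * x) = b * laurentExpectation a x := by
    intro b hb
    induction hb using Algebra.adjoin_induction with
    | mem b hb =>
      obtain rfl : b = core a := hb
      exact laurentExpectation_core_mul ha
    | algebraMap c => intro x; simp only [← Algebra.smul_def, map_smul]
    | add b c _ _ hb hc => intro x; simp only [add_mul, map_add, hb, hc]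
    | mul b c _ _ hb hc => intro x; simp only [mul_assoc, hb, hc]
  have hcheb : ∀ k, chebyshevCore a k ∈ Algebra.adjoin ℂ {core a} := fun k =>
    Polynomial.aeval_mem_adjoin_singleton ℂ _
  refine ⟨fun x => ?_, hleft, fun b hb x => ?_, laurentExpectation_one a, by simp, by simp,
    by simp⟩
  · induction x using LaurentPolynomial.induction_on' with
    | add p q hp hq => rw [map_add]; exact add_mem hp hq
    | C_mul_T n c =>
      rw [← smul_eq_C_mul, map_smul, laurentExpectation_T]
      exact Subalgebra.smul_mem _ (Subalgebra.smul_mem _ (add_mem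
        (Subalgebra.smul_mem _ (hcheb _) _) (Subalgebra.smul_mem _ (hcheb _) _)) _) _
  · rw [mul_comm, hleft b hb, mul_comm]

lemma exists_isInsertionOne : ∃ I, IsInsertionOne a I := by
  have hD := tlData_gen a le_rfl
  have hs := hD.sq 1 le_rfl le_rfl
  have hinv := crossing_mul_crossing_inv ha hs
  have hinv' := crossing_mul_crossing_inv (inv_ne_zero ha) (by rwa [loop_inv])
  rw [inv_inv] at hinv'
  let u : (TL a (1 + 1))ˣ := ⟨R a (1 + 1) * crossing a⁻¹ (gen a 1 1),
    crossing a (gen a 1 1) * Ri a (1 + 1),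
    by rw [mul_assoc, ← mul_assoc (crossing _ _), hinv', one_mul, hD.mul_inv],
    by rw [mul_assoc, ← mul_assoc (Ri _ _), hD.inv_mul, one_mul, hinv]⟩
  refine ⟨AddMonoidAlgebra.lift ℂ _ _ ((Units.coeHom _).comp (zpowersHom _ u)), ?_, ?_⟩
  · rw [T, AddMonoidAlgebra.lift_single]
    simp [u]
  · rw [T, AddMonoidAlgebra.lift_single]
    simp [u]

lemma IsInsertionOne.exists_isJonesExtension {I : LaurentPolynomial ℂ →ₐ[ℂ] TL a (1 + 1)}
    (hI : IsInsertionOne a I) :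
    ∃ Φ, IsJonesExtension (isExpectation_laurent ha) I (gen a 1 1) Φ := by
  set h := isExpectation_laurent ha
  have hD := tlData_gen a le_rfl
  have hs := hD.sq 1 le_rfl le_rfl
  have hs' : gen a 1 1 * gen a 1 1 = loop a⁻¹ • gen a 1 1 := by rwa [loop_inv]
  have hinv' := crossing_mul_crossing_inv (inv_ne_zero ha) hs'
  rw [inv_inv] at hinv'
  have hcore : core a ∈ Algebra.adjoin ℂ {core a} := Algebra.subset_adjoin rfl
  have hjinv := crossing_mul_crossing_inv ha (jones_mul_jones h)
  have hTT : (T 1 * T (-1) : LaurentPolynomial ℂ) = 1 := by rw [← T_add]; simp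
  have hTT' : (T (-1) * T 1 : LaurentPolynomial ℂ) = 1 := by rw [mul_comm, hTT]
  have hext := TLData.ofJones ha (t := act _ _ (T 1)) (t' := act _ _ (T (-1)))
    (ε := jones h) (z := act _ _ (core a))
    (by rw [← map_mul, hTT, map_one])
    (by rw [← map_mul, hTT', map_one])
    (by rw [core, map_add, map_smul, map_smul]) (jones_mul_jones h) (jones_mul_act h hcore)
    (by
      rw [jones_mul_act_mul_jones, laurentExpectation_T_one, map_smul, smul_mul_assoc])
  obtain ⟨Φ, hΦR, hΦRi, hΦgen⟩ := hext.exists_algHom le_rfl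
  have hΦe : Φ (gen a 1 1) = jones h := hΦgen 1 le_rfl le_rfl
  have hshift := hD.shift_top
  have htop := hD.top
  simp only [word, one_mul, zero_add] at htop
  have hRe : R a (1 + 1) * gen a 1 1 = Ri a (1 + 1) * gen a 1 1 := by
    conv_rhs => rw [← htop, ← mul_assoc, ← mul_assoc, hD.inv_mul, one_mul]
  have heR : gen a 1 1 * R a (1 + 1) = gen a 1 1 * Ri a (1 + 1) := by
    conv_rhs => rw [← htop, hshift, mul_assoc, mul_assoc, hD.mul_inv, mul_one]
  have hcore_left : gen a 1 1 * I (core a) = gen a 1 1 * R a (1 + 1) * gen a 1 1 := by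
    rw [core, map_add, map_smul, map_smul, hI.map_T, hI.map_T_neg]
    simp only [crossing, mul_add, add_mul, smul_mul_assoc, mul_smul_comm,
      Algebra.algebraMap_eq_smul_one, one_mul, mul_one, smul_add, ← mul_assoc, hs, inv_inv, ← heR]
    match_scalars <;> field_simp
    ring
  have hcore_right : I (core a) * gen a 1 1 = gen a 1 1 * R a (1 + 1) * gen a 1 1 := by
    rw [core, map_add, map_smul, map_smul, hI.map_T, hI.map_T_neg]
    simp only [crossing, mul_add, add_mul, smul_mul_assoc, mul_smul_comm,
      Algebra.algebraMap_eq_smul_one, one_mul, mul_one, smul_add, mul_assoc, hs, inv_inv, ← hRe]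
    match_scalars <;> field_simp
    ring
  have hcomm : Commute (gen a 1 1) (I (core a)) := hcore_left.trans hcore_right.symm
  refine ⟨Φ, ?_, hΦe, ?_, hs, ?_, ?_⟩
  · have hT : Φ (I (T 1)) = act _ _ (T 1) := by
      rw [hI.map_T, map_mul, map_crossing, hΦR, hΦe, mul_assoc, hjinv, mul_one]
    have hT' : Φ (I (T (-1))) = act _ _ (T (-1)) := by
      rw [hI.map_T_neg, map_mul, map_crossing, hΦRi, hΦe, ← mul_assoc, hjinv, one_mul]
    intro x
    induction x using LaurentPolynomial.induction_on with
    | h_C c =>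
      exact ((Φ.comp I).commutes c).trans ((act _ _).commutes c).symm
    | h_add hp hq => simp only [map_add, hp, hq]
    | h_C_mul_T n c h =>
      rw [T_add, ← mul_assoc, map_mul I, map_mul Φ, map_mul (act _ _), hT, h]
    | h_C_mul_T_Z n c h =>
      rw [sub_eq_add_neg, T_add, ← mul_assoc, map_mul I, map_mul Φ, map_mul (act _ _), hT', h]
  · rw [eq_top_iff, ← adjoin_eq_top 1]
    refine Algebra.adjoin_le ?_
    set S := Algebra.adjoin ℂ (Set.range I ∪ {gen a 1 1})
    have hIS : ∀ x, I x ∈ S := fun x => Algebra.subset_adjoin (Or.inl ⟨x, rfl⟩)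
    have heS : gen a 1 1 ∈ S := Algebra.subset_adjoin (Or.inr rfl)
    have hcS : ∀ b, crossing b (gen a 1 1) ∈ S := fun b =>
      add_mem (S.smul_mem heS _) (algebraMap_mem _ _)
    rintro _ (rfl | rfl | rfl)
    · have := mul_mem (hIS (T 1)) (hcS a)
      rwa [hI.map_T, mul_assoc, hinv', mul_one] at this
    · have := mul_mem (hcS a⁻¹) (hIS (T (-1)))
      rwa [hI.map_T_neg, ← mul_assoc, hinv', one_mul] at this
    · rwa [← gen_one]
  · have hle : Algebra.adjoin ℂ {core a} ≤
        (Subalgebra.centralizer ℂ {gen a 1 1}).comap I := by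
      refine Algebra.adjoin_le (Set.singleton_subset_iff.2 ?_)
      exact Subalgebra.mem_centralizer_iff ℂ |>.2 fun g hg => by
        rw [Set.mem_singleton_iff.1 hg]
        exact hcomm.eq
    intro b hb
    exact Subalgebra.mem_centralizer_iff ℂ |>.1 (hle hb) _ rfl
  · let f : LaurentPolynomial ℂ →ₗ[ℂ] TL a (1 + 1) :=
      LinearMap.mulRight ℂ (gen a 1 1) ∘ₗ LinearMap.mulLeft ℂ (gen a 1 1) ∘ₗ I.toLinearMap
    let g : LaurentPolynomial ℂ →ₗ[ℂ] TL a (1 + 1) :=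
      LinearMap.mulRight ℂ (gen a 1 1) ∘ₗ I.toLinearMap ∘ₗ laurentExpectation a
    have hf : ∀ x, f x = gen a 1 1 * I x * gen a 1 1 := fun x => rfl
    have hg : ∀ x, g x = I (laurentExpectation a x) * gen a 1 1 := fun x => rfl
    have hcm : ∀ x, f x = g x → f (core a * x) = g (core a * x) := by
      intro x hx
      rw [hf, hg] at hx ⊢
      rw [laurentExpectation_core_mul ha, map_mul, map_mul, ← mul_assoc, hcomm.eq, mul_assoc,
        mul_assoc, ← mul_assoc (gen a 1 1), hx, mul_assoc]
    have hzero : f (T 0) = g (T 0) := by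
      rw [hf, hg, T_zero, map_one, laurentExpectation_one, map_smul, map_one, mul_one, hs,
        smul_one_mul]
    have hone : f (T 1) = g (T 1) := by
      rw [hf, hg, hI.map_T, laurentExpectation_T_one, map_smul, smul_mul_assoc, hcore_right,
        mul_assoc, mul_assoc, crossing_mul_self (inv_ne_zero ha) hs']
      simp only [mul_smul_comm, mul_assoc]
    have hadd : ∀ k, f (core a * T k) = a • f (T (k + 1)) + a⁻¹ • f (T (k - 1)) := fun k => by
      rw [core_mul_T, map_add, map_smul, map_smul]
    have hadd' : ∀ k, g (core a * T k) = a • g (T (k + 1)) + a⁻¹ • g (T (k - 1)) := fun k => by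
      rw [core_mul_T, map_add, map_smul, map_smul]
    have key : ∀ k : ℤ, f (T k) = g (T k) ∧ f (T (k + 1)) = g (T (k + 1)) := by
      intro k
      induction k using Int.induction_on with
      | zero => exact ⟨hzero, by simpa using hone⟩
      | succ k ih =>
        refine ⟨ih.2, ?_⟩
        have := hcm _ ih.2
        rw [hadd, hadd', add_sub_cancel_right, ih.1, add_left_inj] at this
        exact smul_right_injective _ ha this
      | pred k ih =>
        rw [sub_add_cancel]
        refine ⟨?_, ih.1⟩
        have := hcm _ ih.1
        rw [hadd, hadd', ih.2, add_right_inj] at this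
        exact smul_right_injective _ (inv_ne_zero ha) this
    intro x
    have hfg : f = g := linearMap_induction fun k => (key k).1
    exact LinearMap.congr_fun hfg x

lemma hasExpectation {k : ℕ} (hk : 1 ≤ k) : HasExpectation a k := by
  induction k, hk using Nat.le_induction with
  | base =>
    obtain ⟨I, hI⟩ := exists_isInsertionOne ha
    obtain ⟨Φ, hJ⟩ := hI.exists_isJonesExtension ha
    exact hJ.hasExpectation hI.range_eq
  | succ k hk ih => exact ih.succ ha hk

end Laurent

/-- for every `n ≥ 1` the algebra homomorphism `I_n : TL_n → TL_{n+1}`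
is injective (the case `n = 1` with `TL_1 = ℂ[ρ,ρ⁻¹]` stated separately). -/
theorem statement3 (t4 : ℂ) (ht4 : t4 ≠ 0) :
    (∀ I : LaurentPolynomial ℂ →ₐ[ℂ] TL t4 2, InsCondOne t4 I → Function.Injective I) ∧
    (∀ n : ℕ, 2 ≤ n → ∀ I : TL t4 n →ₐ[ℂ] TL t4 (n + 1), InsCond t4 n I →
      Function.Injective I) := by
  refine ⟨fun I hI => ?_, fun n hn I hI => ?_⟩
  · have hI' : IsInsertionOne t4 I :=
      ⟨by rw [hI.1, gen_one, crossing, inv_inv]; rfl, by rw [hI.2, gen_one]; rfl⟩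
    obtain ⟨Φ, hJ⟩ := hI'.exists_isJonesExtension ht4
    exact hJ.injective
  · obtain ⟨k, rfl⟩ : ∃ k, n = k + 1 := ⟨n - 1, by omega⟩
    refine (hasExpectation ht4 (k := k) (by omega)).injective ht4 (by omega)
      ⟨?_, hI.2.2.2, fun i h1 h2 => hI.1 i h1 h2⟩
    rw [hI.2.2.1, crossing, inv_inv]
    rfl

end SkeinTL
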